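/- Let β > −1, γ > 0, δ > 0, let U(x) = e^{−x}, and fix η > 0. Then the remainder of the series approximation of the Erdélyi–Kober integral of U satisfies the asymptotic relation I^{β,γ}_δ U(η) − e^{−η} Σ_{k=0}^{N−1} (−1)^k λ_k η^k / k! ∼ δ (Γ(δ(β+1))/Γ(γ)) · e^{−η} η^N / (N^{δ(β+1)} N!) as N → ∞; that is, the ratio of the left-hand side to e^{−η} η^N / (N^{δ(β+1)} N!) tends to δ Γ(δ(β+1))/Γ(γ). -/

import Mathlib

/-- The Erdélyi–Kober fractional integral
`I^{β,γ}_δ U(η) = (1/Γ(γ)) ∫_0^1 (1−z)^{γ−1} z^β U(η z^{1/δ}) dz`. -/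
noncomputable def erdelyiKober (β γ δ : ℝ) (U : ℝ → ℝ) (η : ℝ) : ℝ :=
  (1 / Real.Gamma γ) * ∫ z in (0:ℝ)..1, (1 - z) ^ (γ - 1) * z ^ β * U (η * z ^ (1 / δ))

/-- The coefficients
`λ_k = ((−1)^k/Γ(γ)) ∫_0^1 (1−z)^{γ−1} z^β (1−z^{1/δ})^k dz`. -/
noncomputable def ekCoeff (β γ δ : ℝ) (k : ℕ) : ℝ :=
  ((-1 : ℝ) ^ k / Real.Gamma γ) *
    ∫ z in (0:ℝ)..1, (1 - z) ^ (γ - 1) * z ^ β * (1 - z ^ (1 / δ)) ^ k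

open Set MeasureTheory Filter Topology in
/-- The Jacobi weight on `(0, 1)` is integrable. -/
theorem intervalIntegrable_one_sub_rpow_mul_rpow {β γ : ℝ} (hβ : -1 < β) (hγ : 0 < γ) :
    IntervalIntegrable (fun z : ℝ => (1 - z) ^ (γ - 1) * z ^ β) volume 0 1 := by
  have h := (Complex.betaIntegral_convergent (u := (β + 1 : ℝ)) (v := (γ : ℝ))
    (by simp only [Complex.ofReal_re]; linarith) (by simpa)).norm
  refine h.congr fun z hz => ?_
  rw [uIoc_of_le zero_le_one] at hz
  have h1 : 0 ≤ 1 - z := by linarith [hz.2]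
  have e1 : (z : ℂ) ^ (((β + 1 : ℝ) : ℂ) - 1) = ((z ^ β : ℝ) : ℂ) := by
    rw [Complex.ofReal_cpow hz.1.le]; push_cast; ring_nf
  have e2 : (1 - (z : ℂ)) ^ ((γ : ℂ) - 1) = (((1 - z) ^ (γ - 1) : ℝ) : ℂ) := by
    rw [Complex.ofReal_cpow h1]; push_cast; ring_nf
  have hz0 : 0 ≤ z ^ β := Real.rpow_nonneg hz.1.le _
  have h10 : 0 ≤ (1 - z) ^ (γ - 1) := Real.rpow_nonneg h1 _
  simp only [e1, e2, norm_mul, Complex.norm_real, Real.norm_of_nonneg hz0,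
    Real.norm_of_nonneg h10]
  ring

/-- `1 - z ^ p` is controlled by `1 - z` on the unit interval. -/
theorem one_sub_rpow_le_max_mul {p z : ℝ} (hz : 0 < z) (hz1 : z ≤ 1) :
    1 - z ^ p ≤ max 1 p * (1 - z) := by
  have h1 : 0 ≤ 1 - z := by linarith
  rcases le_total 1 p with hp | hp
  · have := one_add_mul_self_le_rpow_one_add (s := z - 1) (by linarith) hp
    rw [add_sub_cancel] at this
    rw [max_eq_right hp]
    linarith
  · have := Real.rpow_le_rpow_of_exponent_ge hz hz1 hp
    rw [Real.rpow_one] at this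
    rw [max_eq_left hp]
    linarith

/-- The singular factor `(1 - z) ^ (γ - 1)` is absorbed by one power of `1 - z ^ p`. -/
theorem one_sub_rpow_mul_one_sub_rpow_le {γ p z : ℝ} (hγ : 0 < γ)
    (hz : 0 < z) (hz1 : z < 1) : (1 - z) ^ (γ - 1) * (1 - z ^ p) ≤ max 1 p := by
  have h1 : 0 < 1 - z := by linarith
  calc (1 - z) ^ (γ - 1) * (1 - z ^ p)
      ≤ (1 - z) ^ (γ - 1) * (max 1 p * (1 - z)) :=
        mul_le_mul_of_nonneg_left (one_sub_rpow_le_max_mul hz hz1.le) (by positivity)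
    _ = max 1 p * (1 - z) ^ γ := by
        rw [Real.rpow_sub_one h1.ne']; field_simp
    _ ≤ max 1 p * 1 :=
        mul_le_mul_of_nonneg_left (Real.rpow_le_one h1.le (by linarith) hγ.le)
          (zero_le_one.trans (le_max_left _ _))
    _ = max 1 p := mul_one _

/-- The tail of the exponential series at a nonnegative point is at most its first term times
`exp x`. -/
theorem exp_sub_sum_range_le {x : ℝ} (hx : 0 ≤ x) (n : ℕ) :
    Real.exp x - ∑ k ∈ Finset.range n, x ^ k / (k.factorial : ℝ) ≤
      x ^ n / (n.factorial : ℝ) * Real.exp x := by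
  have hs := Real.summable_pow_div_factorial x
  have hexp : Real.exp x = ∑' k : ℕ, x ^ k / (k.factorial : ℝ) := by
    rw [Real.exp_eq_exp_ℝ]; exact (NormedSpace.expSeries_div_hasSum_exp x).tsum_eq.symm
  have hsplit := hs.sum_add_tsum_nat_add n
  have hle : ∑' k : ℕ, x ^ (k + n) / ((k + n).factorial : ℝ) ≤
      ∑' k : ℕ, x ^ n / (n.factorial : ℝ) * (x ^ k / (k.factorial : ℝ)) := by
    refine Summable.tsum_le_tsum (fun k => ?_) ((summable_nat_add_iff n).2 hs) (hs.mul_left _)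
    have hfac : (k.factorial : ℝ) * n.factorial ≤ (k + n).factorial := by
      exact_mod_cast Nat.le_of_dvd (Nat.factorial_pos _)
        (Nat.factorial_mul_factorial_dvd_factorial_add k n)
    rw [div_mul_div_comm, ← pow_add, add_comm n k, mul_comm (n.factorial : ℝ)]
    gcongr
  rw [tsum_mul_left, ← hexp] at hle
  linarith

/-- The tail of the exponential series at a nonnegative point is at least its first term. -/
theorem pow_div_factorial_le_exp_sub_sum_range {x : ℝ} (hx : 0 ≤ x) (n : ℕ) :
    x ^ n / (n.factorial : ℝ) ≤
      Real.exp x - ∑ k ∈ Finset.range n, x ^ k / (k.factorial : ℝ) := by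
  have := Real.sum_le_exp_of_nonneg hx (n + 1)
  rw [Finset.sum_range_succ] at this
  linarith

open Set MeasureTheory Filter Topology in
/-- Laplace-type asymptotics of the moments of `1 - z ^ p` against the Jacobi weight. -/
theorem tendsto_rpow_mul_integral_one_sub_rpow_pow {β γ p : ℝ}
    (hβ : -1 < β) (hγ : 0 < γ) (hp : 0 < p) :
    Tendsto (fun n : ℕ => (n : ℝ) ^ ((β + 1) / p) *
        ∫ z in (0 : ℝ)..1, (1 - z) ^ (γ - 1) * z ^ β * (1 - z ^ p) ^ n)
      atTop (𝓝 (1 / p * Real.Gamma ((β + 1) / p))) := by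
  rw [← integral_rpow_mul_exp_neg_rpow hp hβ]
  set g : ℕ → ℝ → ℝ := fun n =>
    indicator (Ioo 0 1) (fun z => (1 - z) ^ (γ - 1) * z ^ β * (1 - z ^ p) ^ n) with hg
  set b : ℕ → ℝ := fun n => (n : ℝ) ^ (-(1 / p)) with hb
  have hbpos : ∀ n : ℕ, 0 < n → 0 < b n := fun n hn => by
    have : (0 : ℝ) < n := by exact_mod_cast hn
    positivity
  have hbp : ∀ (n : ℕ) (v : ℝ), 0 < n → 0 < v → (b n * v) ^ p = v ^ p / n := fun n v hn hv => by
    have h0 : (0 : ℝ) < n := by exact_mod_cast hn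
    rw [Real.mul_rpow (hbpos n hn).le hv.le, hb, ← Real.rpow_mul h0.le,
      show -(1 / p) * p = -1 by field_simp, Real.rpow_neg_one]
    ring
  have hbβ : ∀ (n : ℕ) (v : ℝ), 0 < n → 0 < v →
      (n : ℝ) ^ (β / p) * (b n * v) ^ β = v ^ β := fun n v hn hv => by
    have h0 : (0 : ℝ) < n := by exact_mod_cast hn
    rw [Real.mul_rpow (hbpos n hn).le hv.le, hb, ← Real.rpow_mul h0.le, ← mul_assoc,
      ← Real.rpow_add h0, show β / p + -(1 / p) * β = 0 by ring, Real.rpow_zero, one_mul]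
  have hscale : ∀ n : ℕ, 0 < n → ∫ v in Ioi (0 : ℝ), (n : ℝ) ^ (β / p) * g n (b n * v) =
      (n : ℝ) ^ ((β + 1) / p) *
        ∫ z in (0 : ℝ)..1, (1 - z) ^ (γ - 1) * z ^ β * (1 - z ^ p) ^ n := fun n hn => by
    have h0 : (0 : ℝ) < n := by exact_mod_cast hn
    rw [integral_const_mul, integral_comp_mul_left_Ioi _ _ (hbpos n hn), mul_zero, hg,
      setIntegral_indicator measurableSet_Ioo, inter_eq_self_of_subset_right Ioo_subset_Ioi_self,
      ← integral_Ioc_eq_integral_Ioo, ← intervalIntegral.integral_of_le zero_le_one, smul_eq_mul,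
      ← mul_assoc, hb, ← Real.rpow_neg h0.le, ← Real.rpow_add h0]
    congr 2
    ring
  have hlim : Tendsto (fun n : ℕ => ∫ v in Ioi (0 : ℝ), (n : ℝ) ^ (β / p) * g n (b n * v)) atTop
      (𝓝 (∫ v in Ioi (0 : ℝ), v ^ β * Real.exp (-v ^ p))) := by
    refine tendsto_integral_filter_of_dominated_convergence
      (fun v => max 1 p * (v ^ β * Real.exp (-(1 / 2) * v ^ p))) ?_ ?_ ?_ ?_
    · refine Eventually.of_forall fun n => Measurable.aestronglyMeasurable ?_
      have : Measurable (g n) := Measurable.indicator (by fun_prop) measurableSet_Ioo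
      fun_prop
    · filter_upwards [eventually_ge_atTop 2] with n hn
      refine (ae_restrict_mem measurableSet_Ioi).mono fun v hv => ?_
      have hv : 0 < v := hv
      have hn0 : 0 < n := by omega
      have h0 : (2 : ℝ) ≤ n := by exact_mod_cast hn
      by_cases hmem : b n * v ∈ Ioo (0 : ℝ) 1
      · have h1 : 0 < 1 - b n * v := by linarith [hmem.2]
        have hq : 0 ≤ 1 - (b n * v) ^ p := by
          linarith [Real.rpow_le_one hmem.1.le hmem.2.le hp.le]
        have hexp : (1 - (b n * v) ^ p) ^ (n - 1) ≤ Real.exp (-(1 / 2) * v ^ p) := by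
          calc (1 - (b n * v) ^ p) ^ (n - 1) ≤ Real.exp (-(b n * v) ^ p) ^ (n - 1) :=
                pow_le_pow_left₀ hq (Real.one_sub_le_exp_neg _) _
            _ = Real.exp (-(((n : ℝ) - 1) / n) * v ^ p) := by
                rw [← Real.exp_nat_mul, hbp n v hn0 hv, Nat.cast_sub (by omega)]
                congr 1
                push_cast
                ring
            _ ≤ Real.exp (-(1 / 2) * v ^ p) := by
                have : 1 / 2 ≤ ((n : ℝ) - 1) / n := by
                  rw [div_le_div_iff₀ (by norm_num) (by linarith)]; linarith
                gcongr
        have heq : (n : ℝ) ^ (β / p) * g n (b n * v) =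
            ((1 - b n * v) ^ (γ - 1) * (1 - (b n * v) ^ p)) *
              (v ^ β * (1 - (b n * v) ^ p) ^ (n - 1)) := by
          rw [← hbβ n v hn0 hv, hg]
          simp only [indicator_of_mem hmem]
          obtain ⟨m, rfl⟩ : ∃ m, n = m + 1 := ⟨n - 1, by omega⟩
          rw [Nat.add_sub_cancel, pow_succ]
          ring
        rw [heq, Real.norm_of_nonneg (by positivity)]
        have := one_sub_rpow_mul_one_sub_rpow_le (p := p) hγ hmem.1 hmem.2
        gcongr
      · rw [hg]
        simp only [indicator_of_notMem hmem, mul_zero, norm_zero]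
        have : 0 ≤ max 1 p := zero_le_one.trans (le_max_left _ _)
        positivity
    · exact (integrableOn_rpow_mul_exp_neg_mul_rpow hβ hp (by norm_num)).const_mul _
    · refine (ae_restrict_mem measurableSet_Ioi).mono fun v hv => ?_
      have hv : 0 < v := hv
      have hbv : Tendsto (fun n : ℕ => b n * v) atTop (𝓝 0) := by
        have := ((tendsto_rpow_neg_atTop (y := 1 / p) (by positivity)).comp
          tendsto_natCast_atTop_atTop).mul_const v
        simpa [hb, Function.comp_def] using this
      have hone : Tendsto (fun n : ℕ => (1 - b n * v) ^ (γ - 1)) atTop (𝓝 1) := by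
        have := (tendsto_const_nhds (x := (1 : ℝ))).sub hbv
        rw [sub_zero] at this
        simpa using this.rpow_const (p := γ - 1) (Or.inl one_ne_zero)
      have hmain := hone.mul ((Real.tendsto_one_add_div_pow_exp (-v ^ p)).const_mul (v ^ β))
      rw [one_mul] at hmain
      refine hmain.congr' ?_
      filter_upwards [hbv.eventually (gt_mem_nhds one_pos), eventually_gt_atTop 0] with n h1 hn
      have hmem : b n * v ∈ Ioo (0 : ℝ) 1 := ⟨mul_pos (hbpos n hn) hv, h1⟩
      rw [hg]
      simp only [indicator_of_mem hmem]
      rw [hbp n v hn hv, ← hbβ n v hn hv]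
      ring
  refine hlim.congr' ?_
  filter_upwards [eventually_gt_atTop 0] with n hn using hscale n hn

/-- The remainder is a weighted integral of the tail of the exponential series. -/
theorem erdelyiKober_exp_sub_sum_eq_integral {β γ δ : ℝ} (η : ℝ)
    (hβ : -1 < β) (hγ : 0 < γ) (hδ : 0 < δ) (N : ℕ) :
    erdelyiKober β γ δ (fun x => Real.exp (-x)) η -
        Real.exp (-η) *
          ∑ k ∈ Finset.range N, (-1 : ℝ) ^ k * ekCoeff β γ δ k * η ^ k / (k.factorial : ℝ) =
      Real.exp (-η) / Real.Gamma γ * ∫ z in (0 : ℝ)..1, (1 - z) ^ (γ - 1) * z ^ β *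
        (Real.exp (η * (1 - z ^ (1 / δ))) -
          ∑ k ∈ Finset.range N, (η * (1 - z ^ (1 / δ))) ^ k / (k.factorial : ℝ)) := by
  have hw := intervalIntegrable_one_sub_rpow_mul_rpow hβ hγ
  have hc : Continuous fun z : ℝ => z ^ (1 / δ) :=
    Real.continuous_rpow_const (by positivity)
  have hterm : ∀ k : ℕ, IntervalIntegrable (fun z : ℝ => (1 - z) ^ (γ - 1) * z ^ β *
      ((η * (1 - z ^ (1 / δ))) ^ k / (k.factorial : ℝ))) MeasureTheory.volume 0 1 := fun k =>
    hw.mul_continuousOn (by fun_prop)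
  have hsum : IntervalIntegrable (fun z : ℝ => ∑ k ∈ Finset.range N, (1 - z) ^ (γ - 1) * z ^ β *
      ((η * (1 - z ^ (1 / δ))) ^ k / (k.factorial : ℝ))) MeasureTheory.volume 0 1 := by
    simpa only [Finset.sum_fn] using IntervalIntegrable.sum (Finset.range N) fun k _ => hterm k
  simp_rw [mul_sub ((1 - _ : ℝ) ^ (γ - 1) * _), Finset.mul_sum]
  rw [intervalIntegral.integral_sub (hw.mul_continuousOn (by fun_prop)) hsum,
    intervalIntegral.integral_finsetSum fun k _ => hterm k, mul_sub, Finset.mul_sum]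
  congr 1
  · rw [erdelyiKober, one_div_mul_eq_div, div_mul_eq_mul_div, ← intervalIntegral.integral_const_mul]
    congr 1
    refine intervalIntegral.integral_congr fun z _ => ?_
    have : Real.exp (-(η * z ^ (1 / δ))) = Real.exp (-η) * Real.exp (η * (1 - z ^ (1 / δ))) := by
      rw [← Real.exp_add]; ring_nf
    simp only [this]
    ring
  · refine Finset.sum_congr rfl fun k _ => ?_
    have : ∫ z in (0 : ℝ)..1, (1 - z) ^ (γ - 1) * z ^ β *
        ((η * (1 - z ^ (1 / δ))) ^ k / (k.factorial : ℝ)) =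
        η ^ k / (k.factorial : ℝ) *
          ∫ z in (0 : ℝ)..1, (1 - z) ^ (γ - 1) * z ^ β * (1 - z ^ (1 / δ)) ^ k := by
      rw [← intervalIntegral.integral_const_mul]
      refine intervalIntegral.integral_congr fun z _ => ?_
      simp only [mul_pow]
      ring
    have hsq : (-1 : ℝ) ^ k * (-1) ^ k = 1 := by rw [← mul_pow]; norm_num
    rw [this, ekCoeff]
    linear_combination (Real.exp (-η) / Real.Gamma γ * η ^ k / (k.factorial : ℝ) *
      ∫ z in (0 : ℝ)..1, (1 - z) ^ (γ - 1) * z ^ β * (1 - z ^ (1 / δ)) ^ k) * hsq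

open Filter Topology in
/-- Two-sided bounds for the weighted integral of the tail of the exponential series by the moments
of `1 - z ^ p`. -/
theorem integral_exp_tail_bounds {β γ p η : ℝ} (hβ : -1 < β) (hγ : 0 < γ) (hp : 0 < p)
    (hη : 0 < η) (N : ℕ) :
    η ^ N / (N.factorial : ℝ) *
        (∫ z in (0 : ℝ)..1, (1 - z) ^ (γ - 1) * z ^ β * (1 - z ^ p) ^ N) ≤
      ∫ z in (0 : ℝ)..1, (1 - z) ^ (γ - 1) * z ^ β * (Real.exp (η * (1 - z ^ p)) -
          ∑ k ∈ Finset.range N, (η * (1 - z ^ p)) ^ k / (k.factorial : ℝ)) ∧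
    (∫ z in (0 : ℝ)..1, (1 - z) ^ (γ - 1) * z ^ β * (Real.exp (η * (1 - z ^ p)) -
          ∑ k ∈ Finset.range N, (η * (1 - z ^ p)) ^ k / (k.factorial : ℝ))) ≤
      (1 + η * Real.exp η / (N + 1)) * (η ^ N / (N.factorial : ℝ) *
        ∫ z in (0 : ℝ)..1, (1 - z) ^ (γ - 1) * z ^ β * (1 - z ^ p) ^ N) := by
  have hw := intervalIntegrable_one_sub_rpow_mul_rpow hβ hγ
  have hc : Continuous fun z : ℝ => z ^ p := Real.continuous_rpow_const hp.le
  have hmom : IntervalIntegrable (fun z : ℝ => (1 - z) ^ (γ - 1) * z ^ β * (1 - z ^ p) ^ N)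
      MeasureTheory.volume 0 1 := hw.mul_continuousOn (by fun_prop)
  have htail : IntervalIntegrable (fun z : ℝ => (1 - z) ^ (γ - 1) * z ^ β *
      (Real.exp (η * (1 - z ^ p)) -
        ∑ k ∈ Finset.range N, (η * (1 - z ^ p)) ^ k / (k.factorial : ℝ)))
      MeasureTheory.volume 0 1 := hw.mul_continuousOn (by fun_prop)
  have hpos : ∀ z ∈ Set.Icc (0 : ℝ) 1,
      0 ≤ (1 - z) ^ (γ - 1) * z ^ β ∧ 0 ≤ 1 - z ^ p ∧ 1 - z ^ p ≤ 1 := fun z hz => by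
    refine ⟨mul_nonneg (Real.rpow_nonneg (by linarith [hz.2]) _) (Real.rpow_nonneg hz.1 _), ?_, ?_⟩
    · linarith [Real.rpow_le_one hz.1 hz.2 hp.le]
    · linarith [Real.rpow_nonneg hz.1 p]
  rw [← mul_assoc, ← intervalIntegral.integral_const_mul, ← intervalIntegral.integral_const_mul]
  constructor
  · refine intervalIntegral.integral_mono_on zero_le_one (hmom.const_mul _) htail fun z hz => ?_
    obtain ⟨hW, ht0, -⟩ := hpos z hz
    have h := mul_le_mul_of_nonneg_left
      (pow_div_factorial_le_exp_sub_sum_range (mul_nonneg hη.le ht0) N) hW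
    refine le_trans (le_of_eq ?_) h
    rw [mul_pow]
    ring
  · refine intervalIntegral.integral_mono_on zero_le_one htail (hmom.const_mul _) fun z hz => ?_
    obtain ⟨hW, ht0, ht1⟩ := hpos z hz
    set t := 1 - z ^ p
    have hx : 0 ≤ η * t := mul_nonneg hη.le ht0
    have h := exp_sub_sum_range_le hx (N + 1)
    rw [Finset.sum_range_succ] at h
    have h2 : (η * t) ^ (N + 1) / ((N + 1).factorial : ℝ) * Real.exp (η * t) ≤
        η ^ N / (N.factorial : ℝ) * t ^ N * (η * Real.exp η / (N + 1)) := by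
      calc (η * t) ^ (N + 1) / ((N + 1).factorial : ℝ) * Real.exp (η * t)
          = η ^ N / (N.factorial : ℝ) * t ^ N * (η * (t * Real.exp (η * t)) / (N + 1)) := by
            rw [Nat.factorial_succ, pow_succ, mul_pow]; push_cast; field_simp
        _ ≤ η ^ N / (N.factorial : ℝ) * t ^ N * (η * (1 * Real.exp (η * 1)) / (N + 1)) := by
            gcongr
        _ = _ := by rw [one_mul, mul_one]
    have h3 : Real.exp (η * t) - ∑ k ∈ Finset.range N, (η * t) ^ k / (k.factorial : ℝ) ≤
        (1 + η * Real.exp η / (N + 1)) * (η ^ N / (N.factorial : ℝ)) * t ^ N := by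
      have : (η * t) ^ N / (N.factorial : ℝ) = η ^ N / (N.factorial : ℝ) * t ^ N := by
        rw [mul_pow]; ring
      linarith
    exact (mul_le_mul_of_nonneg_left h3 hW).trans_eq (by ring)

/-- asymptotics of the `N`-term truncation error for `U(x) = e^{−x}`:
the remainder is asymptotic to
`δ (Γ(δ(β+1))/Γ(γ)) e^{−η} η^N / (N^{δ(β+1)} N!)` as `N → ∞`. -/
theorem ek_exp_remainder_asymptotics (β γ δ η : ℝ)
    (hβ : -1 < β) (hγ : 0 < γ) (hδ : 0 < δ) (hη : 0 < η) :
    Filter.Tendsto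
      (fun N : ℕ =>
        (erdelyiKober β γ δ (fun x => Real.exp (-x)) η -
            Real.exp (-η) *
              ∑ k ∈ Finset.range N, (-1 : ℝ) ^ k * ekCoeff β γ δ k * η ^ k / (k.factorial : ℝ)) /
          (Real.exp (-η) * η ^ N / ((N : ℝ) ^ (δ * (β + 1)) * (N.factorial : ℝ))))
      Filter.atTop
      (nhds (δ * Real.Gamma (δ * (β + 1)) / Real.Gamma γ)) := by
  have hp : 0 < 1 / δ := by positivity
  have hG : 0 < Real.Gamma γ := Real.Gamma_pos_of_pos hγ
  have hmom := (tendsto_rpow_mul_integral_one_sub_rpow_pow hβ hγ hp).div_const (Real.Gamma γ)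
  rw [one_div_one_div, show (β + 1) / (1 / δ) = δ * (β + 1) by field_simp] at hmom
  have hfac : Filter.Tendsto (fun N : ℕ => 1 + η * Real.exp η / ((N : ℝ) + 1))
      Filter.atTop (nhds 1) := by
    have := (tendsto_one_div_add_atTop_nhds_zero_nat (𝕜 := ℝ)).const_mul (η * Real.exp η)
    simpa only [mul_one_div, mul_zero, add_zero] using this.const_add 1
  have hupper := hfac.mul hmom
  rw [one_mul] at hupper
  have hrw : ∀ (I : ℝ) (N : ℕ), 0 < N → Real.exp (-η) / Real.Gamma γ * I /
      (Real.exp (-η) * η ^ N / ((N : ℝ) ^ (δ * (β + 1)) * (N.factorial : ℝ))) =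
      (N : ℝ) ^ (δ * (β + 1)) / Real.Gamma γ / (η ^ N / (N.factorial : ℝ)) * I := fun I N hN => by
    have h0 : (0 : ℝ) < N := by exact_mod_cast hN
    have := Real.rpow_pos_of_pos h0 (δ * (β + 1))
    field_simp
  refine tendsto_of_tendsto_of_tendsto_of_le_of_le' hmom hupper ?_ ?_
  · filter_upwards [Filter.eventually_gt_atTop 0] with N hN
    rw [erdelyiKober_exp_sub_sum_eq_integral η hβ hγ hδ, hrw _ N hN]
    refine le_trans (le_of_eq ?_) (mul_le_mul_of_nonneg_left
      (integral_exp_tail_bounds hβ hγ hp hη N).1 (by positivity))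
    field_simp
  · filter_upwards [Filter.eventually_gt_atTop 0] with N hN
    rw [erdelyiKober_exp_sub_sum_eq_integral η hβ hγ hδ, hrw _ N hN]
    refine (mul_le_mul_of_nonneg_left
      (integral_exp_tail_bounds hβ hγ hp hη N).2 (by positivity)).trans_eq ?_
    field_simp
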